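/- arXiv:math/0405136 — 3 statements merged into one kernel-verified Lean document; each statement's English description precedes it below -/
import Mathlib

section
/- For any k-bounded partition λ, the principal order ideal Y_λ^k = {μ : μ ≼ λ} of the k-Young order is a graded poset of rank |λ|: the empty partition is its unique minimal element (∅ ≼ μ for every μ ∈ Y_λ^k), along any covering step the size of the partition increases by exactly one, and consequently every maximal chain of Y_λ^k runs from ∅ to λ and has exactly |λ| + 1 elements. -/
/-- A partition: a weakly decreasing list of positive integers. -/
def IsPartition (l : List ℕ) : Prop :=
  l.Pairwise (· ≥ ·) ∧ ∀ x ∈ l, 0 < x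

/-- The `i`-th part (0-indexed), with parts beyond the length equal to 0. -/
def part (l : List ℕ) (i : ℕ) : ℕ := l.getD i 0

/-- Diagram containment `l ⊆ m`: every part of `l` is at most the corresponding part of `m`. -/
def SubDiag (l m : List ℕ) : Prop := ∀ i, part l i ≤ part m i

/-- A `k`-bounded partition: a partition whose first part is at most `k`. -/
def KBounded (k : ℕ) (l : List ℕ) : Prop := IsPartition l ∧ part l 0 ≤ k

/-- Hook length of the square `(i,j)` (0-indexed) with respect to the skew diagram
`outer/inner`: the number of cells `(i,j')` of the skew diagram with `j' ≥ j` plus the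
number of cells `(i',j)` of the skew diagram with `i' > i`. -/
def hookLen (outer inner : List ℕ) (i j : ℕ) : ℕ :=
  ((Finset.range (part outer i)).filter (fun j' => j ≤ j' ∧ part inner i ≤ j')).card +
  ((Finset.range outer.length).filter
    (fun i' => i < i' ∧ part inner i' ≤ j ∧ j < part outer i')).card

/-- `(outer, inner)` is the `k`-skew diagram of the `k`-bounded partition `l`:
row `i` of `outer/inner` has `l i` cells, every cell of `outer/inner` has hook length
at most `k`, and every square of the inner shape has hook length exceeding `k`. -/
def IsKSkew (k : ℕ) (l outer inner : List ℕ) : Prop :=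
  IsPartition outer ∧ IsPartition inner ∧ SubDiag inner outer ∧
  (∀ i, part outer i - part inner i = part l i) ∧
  (∀ i j, part inner i ≤ j → j < part outer i → hookLen outer inner i j ≤ k) ∧
  (∀ i j, j < part inner i → k < hookLen outer inner i j)

/-- Length of column `j` of the skew diagram `outer/inner`. -/
def colLen (outer inner : List ℕ) (j : ℕ) : ℕ :=
  ((Finset.range outer.length).filter
    (fun i => part inner i ≤ j ∧ j < part outer i)).card

/-- The list of column lengths of the skew diagram `outer/inner`. -/
def skewCols (outer inner : List ℕ) : List ℕ :=
  ((List.range (part outer 0)).map (colLen outer inner)).filter (fun x => decide (x ≠ 0))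

/-- The `k`-conjugate of `l`: the partition whose parts are the column lengths of the
(unique) `k`-skew diagram of `l`. -/
noncomputable def kConj (k : ℕ) (l : List ℕ) : List ℕ :=
  haveI := Classical.dec (∃ p : List ℕ × List ℕ, IsKSkew k l p.1 p.2)
  if h : ∃ p : List ℕ × List ℕ, IsKSkew k l p.1 p.2 then
    skewCols h.choose.1 h.choose.2
  else []

/-- The covering relation of the `k`-Young order on `k`-bounded partitions. -/
def KCover (k : ℕ) (l m : List ℕ) : Prop :=
  KBounded k l ∧ KBounded k m ∧ SubDiag l m ∧
  SubDiag (kConj k l) (kConj k m) ∧ m.sum = l.sum + 1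

/-- The `k`-Young order: reflexive-transitive closure of the covering relation. -/
def KLe (k : ℕ) : List ℕ → List ℕ → Prop := Relation.ReflTransGen (KCover k)

/-- The weakly decreasing rearrangement of the combined parts of two partitions. -/
def punion (l r : List ℕ) : List ℕ := (l ++ r).mergeSort (fun a b => decide (a ≥ b))

/-- The ordinary conjugate of a partition: the list of column lengths of its diagram. -/
def conj (l : List ℕ) : List ℕ :=
  (List.range (part l 0)).map (fun j => (l.filter (fun x => decide (j < x))).length)

/-! ### Column heights built row by row from the top -/

/-- The first column in which a row of `m` cells can start below columns of heights `h`
without creating a hook longer than `k`. -/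
noncomputable def rowShift (k m : ℕ) (h : ℕ → ℕ) : ℕ := sInf {j | h j + m ≤ k}

/-- The column heights after a row of `m` cells is placed below columns of heights `h`. -/
noncomputable def addRow (k m : ℕ) (h : ℕ → ℕ) (j : ℕ) : ℕ :=
  h j + if rowShift k m h ≤ j ∧ j < rowShift k m h + m then 1 else 0

/-- The column heights of the `k`-skew diagram with row lengths `l`. -/
noncomputable def heights (k : ℕ) : List ℕ → ℕ → ℕ
  | [] => fun _ => 0
  | m :: t => addRow k m (heights k t)

/-- Weakly decreasing, eventually zero sequences. -/
def IsHeights (h : ℕ → ℕ) : Prop := Antitone h ∧ ∃ N, ∀ j, N ≤ j → h j = 0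

theorem lt_rowShift_iff {k m : ℕ} {h : ℕ → ℕ} (hh : IsHeights h) (hm : m ≤ k) (j : ℕ) :
    j < rowShift k m h ↔ k < h j + m := by
  obtain ⟨ha, N, hN⟩ := hh
  have hne : {j | h j + m ≤ k}.Nonempty := ⟨N, by simp [hN N le_rfl, hm]⟩
  constructor
  · intro hj
    have := Nat.notMem_of_lt_sInf hj
    simpa using this
  · intro hj
    by_contra! hc
    have h1 : h (rowShift k m h) + m ≤ k := Nat.sInf_mem hne
    have h2 := ha hc
    omega

theorem IsHeights.addRow {k m : ℕ} {h : ℕ → ℕ} (hh : IsHeights h) (hm : m ≤ k) :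
    IsHeights (addRow k m h) := by
  have hs := lt_rowShift_iff hh hm
  obtain ⟨ha, N, hN⟩ := hh
  refine ⟨fun i j hij => ?_, max N (rowShift k m h + m), fun j hj => ?_⟩
  · have h1 := ha hij
    have h2 := hs i
    have h3 := hs j
    unfold _root_.addRow
    split_ifs <;> omega
  · have h1 := hN j (by omega)
    unfold _root_.addRow
    split_ifs <;> omega

theorem isHeights_heights {k : ℕ} {l : List ℕ} (hl : ∀ m ∈ l, m ≤ k) :
    IsHeights (heights k l) := by
  induction l with
  | nil => exact ⟨fun _ _ _ => le_rfl, 0, fun _ _ => rfl⟩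
  | cons m t ih =>
    exact (ih fun x hx => hl x (by simp [hx])).addRow (hl m (by simp))

theorem exists_addRow_eq_add_single {k m q : ℕ} {g h : ℕ → ℕ} (hg : IsHeights g)
    (hh : IsHeights h) (hm : m ≤ k) (hgh : ∀ j, h j = g j + if j = q then 1 else 0) :
    ∃ q', ∀ j, addRow k m h j = addRow k m g j + if j = q' then 1 else 0 := by
  have hsg := lt_rowShift_iff hg hm
  have hsh := lt_rowShift_iff hh hm
  unfold addRow
  generalize rowShift k m h = s at *
  generalize rowShift k m g = r at *
  have hqe := hgh q
  rw [if_pos rfl] at hqe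
  by_cases hsr : s = r
  · subst hsr
    exact ⟨q, fun j => by rw [hgh j]; omega⟩
  · have hother : ∀ j, j ≠ q → (j < r ↔ j < s) := fun j hj => by
      rw [hsg, hsh, hgh j, if_neg hj, add_zero]
    have hrs : r < s := by
      by_contra! hc
      have h1 := (hsg s).1 (by omega)
      have h2 := (hsh s).2 (by have := hgh s; omega)
      omega
    have hrq : r = q := by
      by_contra hc
      have := hother r hc
      omega
    have hs1 : s = r + 1 := by
      by_contra hc
      have := hother (r + 1) (by omega)
      omega
    refine ⟨r + m, fun j => ?_⟩
    rw [hgh j]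
    subst hs1 hrq
    split_ifs <;> omega

/-! ### The `k`-skew diagram and its column lengths -/

theorem part_tail (l : List ℕ) (i : ℕ) : part l.tail i = part l (i + 1) := by
  cases l <;> simp [part]

theorem IsPartition.tail {l : List ℕ} (hl : IsPartition l) : IsPartition l.tail :=
  ⟨hl.1.tail, fun x hx => hl.2 x (List.mem_of_mem_tail hx)⟩

theorem colLen_cons (o : ℕ) (os inner : List ℕ) (j : ℕ) :
    colLen (o :: os) inner j =
      colLen os inner.tail j + if part inner 0 ≤ j ∧ j < o then 1 else 0 := by
  simp only [colLen, List.length_cons, Finset.card_filter, Finset.sum_range_succ', part_tail]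
  rfl

theorem colLen_tail_le (outer inner : List ℕ) (j : ℕ) :
    colLen outer.tail inner.tail j ≤ colLen outer inner j := by
  cases outer with
  | nil => exact (Finset.card_eq_zero.2 (Finset.filter_empty _)).trans_le (Nat.zero_le _)
  | cons o os => rw [colLen_cons]; simp

theorem card_row (a b j : ℕ) :
    ((Finset.range a).filter (fun j' => j ≤ j' ∧ b ≤ j')).card = a - max j b := by
  rw [← Nat.card_Ico]
  congr 1
  ext x
  simp
  omega

theorem hookLen_zero (outer inner : List ℕ) (j : ℕ) :
    hookLen outer inner 0 j =
      (part outer 0 - max j (part inner 0)) + colLen outer.tail inner.tail j := by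
  unfold hookLen
  rw [card_row]
  congr 1
  cases outer with
  | nil => rfl
  | cons o os =>
    simp only [colLen, List.length_cons, Finset.card_filter, Finset.sum_range_succ', part_tail,
      List.tail_cons]
    simp [part]

theorem hookLen_succ (outer inner : List ℕ) (i j : ℕ) :
    hookLen outer inner (i + 1) j = hookLen outer.tail inner.tail i j := by
  unfold hookLen
  rw [card_row, card_row, part_tail, part_tail]
  congr 1
  cases outer with
  | nil => rfl
  | cons o os =>
    simp only [List.length_cons, Finset.card_filter, Finset.sum_range_succ', part_tail,
      List.tail_cons]
    simp [part]

theorem IsKSkew.tail {k m : ℕ} {t outer inner : List ℕ}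
    (h : IsKSkew k (m :: t) outer inner) : IsKSkew k t outer.tail inner.tail := by
  obtain ⟨h1, h2, h3, h4, h5, h6⟩ := h
  refine ⟨h1.tail, h2.tail, fun i => ?_, fun i => ?_, fun i j => ?_, fun i j => ?_⟩
  · simpa only [part_tail] using h3 (i + 1)
  · rw [part_tail, part_tail, h4]
    rfl
  · simpa only [part_tail, hookLen_succ] using h5 (i + 1) j
  · simpa only [part_tail, hookLen_succ] using h6 (i + 1) j

theorem IsKSkew.colLen_eq {k : ℕ} {l outer inner : List ℕ} (hl : ∀ m ∈ l, 0 < m)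
    (h : IsKSkew k l outer inner) : colLen outer inner = heights k l := by
  induction l generalizing outer inner with
  | nil =>
    funext j
    obtain ⟨-, -, -, h4, -⟩ := h
    have : ∀ i, part outer i ≤ part inner i := fun i => by
      have := h4 i
      simp [part] at this ⊢
      omega
    simp only [colLen, heights, Finset.card_eq_zero, Finset.filter_eq_empty_iff]
    intro i _ hi
    have := this i
    omega
  | cons m t ih =>
    have iht := ih (fun x hx => hl x (by simp [hx])) h.tail
    have hm := hl m (by simp)
    obtain ⟨-, -, h3, h4, h5, h6⟩ := h
    have e0 : part outer 0 - part inner 0 = m := h4 0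
    have hs : rowShift k m (heights k t) = part inner 0 := by
      have a5 := h5 0 (part inner 0) le_rfl (by omega)
      rw [hookLen_zero, max_self, e0, iht] at a5
      apply le_antisymm
      · exact Nat.sInf_le (by simp only [Set.mem_ofPred_eq]; omega)
      · refine le_csInf ⟨part inner 0, by simp only [Set.mem_ofPred_eq]; omega⟩ fun j hj => ?_
        by_contra! hc
        have a6 := h6 0 j hc
        rw [hookLen_zero, max_eq_right hc.le, e0, iht] at a6
        simp only [Set.mem_ofPred_eq] at hj
        omega
    cases outer with
    | nil => simp [part] at e0; omega
    | cons o os =>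
      funext j
      have ho : o = part inner 0 + m := by
        have : part (o :: os) 0 = o := rfl
        omega
      rw [colLen_cons, heights, addRow, hs, ← iht, ho]
      rfl

theorem part_zero_eq_zero {l : List ℕ} (hl : IsPartition l) (h : part l 0 = 0) : l = [] := by
  cases l with
  | nil => rfl
  | cons a t =>
    have := hl.2 a (by simp)
    simp [part] at h
    omega

theorem part_zero_ge {l : List ℕ} (hl : IsPartition l) {x : ℕ} (hx : x ∈ l) : x ≤ part l 0 := by
  cases l with
  | nil => simp at hx
  | cons a t =>
    rcases List.mem_cons.1 hx with rfl | hx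
    · exact le_rfl
    · exact List.rel_of_pairwise_cons hl.1 hx

theorem IsPartition.cons {a : ℕ} {l : List ℕ} (hl : IsPartition l) (ha : 0 < a)
    (h : part l 0 ≤ a) : IsPartition (a :: l) := by
  refine ⟨List.pairwise_cons.2 ⟨fun x hx => (part_zero_ge hl hx).trans h, hl.1⟩, ?_⟩
  simpa [ha] using hl.2

theorem KBounded.le {k : ℕ} {l : List ℕ} (hl : KBounded k l) {x : ℕ} (hx : x ∈ l) : x ≤ k :=
  (part_zero_ge hl.1 hx).trans hl.2

theorem exists_isKSkew {k : ℕ} {l : List ℕ} (hl : KBounded k l) :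
    ∃ outer inner, IsKSkew k l outer inner := by
  induction l with
  | nil =>
    refine ⟨[], [], ?_⟩
    simp [IsKSkew, IsPartition, SubDiag, part]
  | cons m t ih =>
    have hm : 0 < m := hl.1.2 m (by simp)
    have hmk : m ≤ k := hl.2
    have hmt : part t 0 ≤ m := by
      cases t with
      | nil => simp [part]
      | cons b u => exact List.rel_of_pairwise_cons hl.1.1 (List.mem_cons_self : b ∈ b :: u)
    have ht : KBounded k t := ⟨hl.1.tail, hmt.trans hmk⟩
    obtain ⟨o, i, hoi⟩ := ih ht
    have hcol := hoi.colLen_eq ht.1.2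
    have hh : IsHeights (heights k t) := isHeights_heights fun x hx => ht.le hx
    have hsh := lt_rowShift_iff hh hmk
    obtain ⟨h1, h2, h3, h4, h5, h6⟩ := hoi
    generalize hs : rowShift k m (heights k t) = s at hsh
    have his : part i 0 ≤ s := by
      by_contra! hc
      have a6 := h6 0 s hc
      rw [hookLen_zero, max_eq_right hc.le, h4 0] at a6
      have a7 := colLen_tail_le o i s
      rw [hcol] at a7
      have := (hsh s).2 (by omega)
      omega
    obtain ⟨inner, hpart, hin0, hint⟩ :
        ∃ inner, IsPartition inner ∧ part inner 0 = s ∧ inner.tail = i := by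
      rcases Nat.eq_zero_or_pos s with h0 | hpos
      · have hi : i = [] := part_zero_eq_zero h2 (by omega)
        exact ⟨[], ⟨by simp, by simp⟩, by simp [part, h0], by simp [hi]⟩
      · exact ⟨s :: i, h2.cons hpos his, rfl, rfl⟩
    have hins : ∀ r, part inner (r + 1) = part i r := fun r => by rw [← hint, part_tail]
    have hout : part ((s + m) :: o) 0 = s + m := rfl
    have houts : ∀ r, part ((s + m) :: o) (r + 1) = part o r := fun r => rfl
    refine ⟨(s + m) :: o, inner, h1.cons (by omega) ?_, hpart, ?_, ?_, ?_, ?_⟩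
    · have := h4 0
      omega
    · rintro (_ | r)
      · rw [hin0, hout]; omega
      · rw [hins, houts]; exact h3 r
    · rintro (_ | r)
      · rw [hin0, hout]; exact Nat.add_sub_cancel_left s m
      · rw [hins, houts]; exact h4 r
    · rintro (_ | r) j hj hj'
      · rw [hookLen_zero, hin0, hout, hint, List.tail_cons, hcol]
        rw [hin0] at hj
        have a1 := hh.1 hj
        have a2 := hsh s
        rw [max_eq_left hj]
        omega
      · rw [hookLen_succ, hint, List.tail_cons]
        rw [hins] at hj
        exact h5 r j hj hj'
    · rintro (_ | r) j hj
      · rw [hookLen_zero, hin0, hout, hint, List.tail_cons, hcol]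
        rw [hin0] at hj
        have a2 := (hsh j).1 hj
        rw [max_eq_right hj.le]
        omega
      · rw [hookLen_succ, hint, List.tail_cons]
        rw [hins] at hj
        exact h6 r j hj

theorem part_filter_map_range {f : ℕ → ℕ} (hf : Antitone f) {n : ℕ}
    (hn : ∀ j, n ≤ j → f j = 0) (j : ℕ) :
    part (((List.range n).map f).filter (fun x => decide (x ≠ 0))) j = f j := by
  induction n generalizing f j with
  | zero => simp [part, hn j]
  | succ n ih =>
    rw [List.range_succ_eq_map, List.map_cons, List.map_map]
    have hf' : Antitone (f ∘ Nat.succ) := fun a b hab => hf (Nat.succ_le_succ hab)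
    have hn' : ∀ j, n ≤ j → (f ∘ Nat.succ) j = 0 := fun j hj => hn _ (Nat.succ_le_succ hj)
    by_cases h0 : f 0 = 0
    · have hz : ∀ x, f x = 0 := fun x => Nat.le_zero.1 (h0 ▸ hf (Nat.zero_le x))
      rw [List.filter_cons_of_neg (by simp [h0]), ih hf' hn']
      simp [hz]
    · rw [List.filter_cons_of_pos (by simp [h0])]
      cases j with
      | zero => rfl
      | succ j => exact ih hf' hn' j

theorem part_le_part_zero {l : List ℕ} (hl : IsPartition l) (i : ℕ) : part l i ≤ part l 0 := by
  by_cases hi : i < l.length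
  · exact part_zero_ge hl (by rw [part, List.getD_eq_getElem _ _ hi]; exact List.getElem_mem hi)
  · rw [part, List.getD_eq_default _ _ (not_lt.1 hi)]
    exact Nat.zero_le _

theorem part_kConj {k : ℕ} {l : List ℕ} (hl : KBounded k l) (j : ℕ) :
    part (kConj k l) j = heights k l j := by
  have hex : ∃ p : List ℕ × List ℕ, IsKSkew k l p.1 p.2 := by
    obtain ⟨o, i, h⟩ := exists_isKSkew hl
    exact ⟨(o, i), h⟩
  have hspec := hex.choose_spec
  rw [kConj, dif_pos hex]
  have hcol := hspec.colLen_eq hl.1.2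
  rw [skewCols, hcol]
  refine part_filter_map_range (isHeights_heights fun x hx => hl.le hx).1 (fun j hj => ?_) j
  rw [← hcol, colLen, Finset.card_eq_zero, Finset.filter_eq_empty_iff]
  intro i _ hi
  have := part_le_part_zero hspec.1 i
  omega

/-! ### Lower covers -/

theorem heights_append_zero (k : ℕ) (p : List ℕ) : heights k (p ++ [0]) = heights k p := by
  induction p with
  | nil =>
    funext j
    have : ¬ (rowShift k 0 (heights k []) ≤ j ∧ j < rowShift k 0 (heights k [])) := by omega
    simp only [List.nil_append, heights, addRow, add_zero] at this ⊢
    rw [if_neg this]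
  | cons m t ih => rw [List.cons_append, heights, ih, heights]

theorem exists_heights_append_succ {k a : ℕ} {p : List ℕ} (ha : a + 1 ≤ k)
    (hp : ∀ m ∈ p, m ≤ k) :
    ∃ q, ∀ j, heights k (p ++ [a + 1]) j =
      heights k (p ++ [a]) j + if j = q then 1 else 0 := by
  induction p with
  | nil =>
    have hs : ∀ m, m ≤ k → rowShift k m (fun _ => 0) = 0 := fun m hm =>
      Nat.le_zero.1 (Nat.sInf_le (by simpa using hm))
    refine ⟨a, fun j => ?_⟩
    simp only [List.nil_append, heights, addRow, hs _ ha, hs a (by omega)]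
    split_ifs <;> omega
  | cons m t ih =>
    have hp' : ∀ x ∈ t, x ≤ k := fun x hx => hp x (by simp [hx])
    obtain ⟨q, hq⟩ := ih hp'
    refine exists_addRow_eq_add_single (isHeights_heights ?_) (isHeights_heights ?_)
      (hp m (by simp)) hq <;>
    · intro x hx
      rcases List.mem_append.1 hx with hx | hx
      · exact hp' x hx
      · simp only [List.mem_singleton] at hx
        omega

theorem exists_kCover {k : ℕ} {l : List ℕ} (hl : KBounded k l) (hne : l ≠ []) :
    ∃ l', KCover k l' l := by
  obtain ⟨p, b, rfl⟩ := (List.eq_nil_or_concat' l).resolve_left hne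
  have hb : 0 < b := hl.1.2 b (by simp)
  obtain ⟨a, rfl⟩ : ∃ a, b = a + 1 := ⟨b - 1, by omega⟩
  obtain ⟨q, hq⟩ := exists_heights_append_succ (hl.le (by simp : a + 1 ∈ p ++ [a + 1]))
    (fun x hx => hl.le (by simp [hx]) : ∀ x ∈ p, x ≤ k)
  have hsub : SubDiag (p ++ [a]) (p ++ [a + 1]) := by
    intro i
    unfold part
    rcases lt_trichotomy i p.length with hi | hi | hi
    · rw [List.getD_append _ _ _ _ hi, List.getD_append _ _ _ _ hi]
    · simp [hi]
    · rw [List.getD_eq_default _ _ (by simp; omega)]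
      exact Nat.zero_le _
  have hpart0 : ∀ i, part p i = part (p ++ [0]) i := by
    intro i
    unfold part
    rcases lt_trichotomy i p.length with hi | hi | hi
    · rw [List.getD_append _ _ _ _ hi]
    · simp [hi]
    · rw [List.getD_eq_default _ _ hi.le, List.getD_eq_default _ _ (by simp; omega)]
  have hpw := List.pairwise_append.1 hl.1.1
  rcases Nat.eq_zero_or_pos a with rfl | ha
  · have hp : KBounded k p := by
      refine ⟨⟨hpw.1, fun x hx => hl.1.2 x (by simp [hx])⟩, ?_⟩
      rw [hpart0]
      exact (hsub 0).trans hl.2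
    refine ⟨p, hp, hl, fun i => hpart0 i ▸ hsub i, fun j => ?_, by simp⟩
    rw [part_kConj hp, part_kConj hl, hq, heights_append_zero]
    omega
  · have hp : KBounded k (p ++ [a]) := by
      refine ⟨⟨List.pairwise_append.2 ⟨hpw.1, by simp, fun x hx y hy => ?_⟩, fun x hx => ?_⟩,
        (hsub 0).trans hl.2⟩
      · have := hpw.2.2 x hx (a + 1) (by simp)
        simp only [List.mem_singleton] at hy
        omega
      · rcases List.mem_append.1 hx with hx | hx
        · exact hl.1.2 x (by simp [hx])
        · simp only [List.mem_singleton] at hx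
          omega
    refine ⟨p ++ [a], hp, hl, hsub, fun j => ?_, by simp; omega⟩
    rw [part_kConj hp, part_kConj hl, hq]
    omega

theorem kLe_nil {k : ℕ} {l : List ℕ} (hl : KBounded k l) : KLe k [] l := by
  induction hn : l.sum generalizing l with
  | zero =>
    by_cases hne : l = []
    · subst hne; exact Relation.ReflTransGen.refl
    · obtain ⟨l', h⟩ := exists_kCover hl hne
      have := h.2.2.2.2
      omega
  | succ n ih =>
    have hne : l ≠ [] := by rintro rfl; simp at hn
    obtain ⟨l', h⟩ := exists_kCover hl hne
    have := h.2.2.2.2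
    exact (ih h.1 (by omega)).tail h

theorem KLe.kBounded {k : ℕ} {l m : List ℕ} (h : KLe k l m) (hm : KBounded k m) :
    KBounded k l := by
  rcases Relation.ReflTransGen.cases_head h with rfl | ⟨_, h, -⟩
  exacts [hm, h.1]

theorem sum_add_length_of_isChain {k : ℕ} {c : List (List ℕ)} {a b : List ℕ}
    (hc : (a :: c).IsChain (KCover k)) (hb : (a :: c).getLast? = some b) :
    b.sum = a.sum + c.length := by
  induction c generalizing a with
  | nil => simp_all
  | cons d c ih =>
    rw [List.isChain_cons_cons] at hc
    rw [List.getLast?_cons_cons] at hb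
    have h1 := ih hc.2 hb
    have h2 := hc.1.2.2.2.2
    rw [List.length_cons]
    omega

/-- the principal order ideal `Y_λ^k` is graded of rank `|λ|`: the empty
partition is below every element, covering steps increase the size by exactly one, and
every saturated chain from `∅` to `λ` has exactly `|λ| + 1` elements. -/
theorem kYoung_ideal_graded (k : ℕ) (lam : List ℕ) (hlam : KBounded k lam) :
    (∀ μ, KLe k μ lam → KLe k [] μ) ∧
    (∀ μ ν, KCover k μ ν → ν.sum = μ.sum + 1) ∧
    (∀ c : List (List ℕ), c.Chain' (KCover k) → (∀ x ∈ c, KLe k x lam) →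
      c.head? = some [] → c.getLast? = some lam → c.length = lam.sum + 1) := by
  refine ⟨fun μ h => kLe_nil (h.kBounded hlam), fun μ ν h => h.2.2.2.2, ?_⟩
  intro c hc _ hhead hlast
  cases c with
  | nil => simp at hhead
  | cons a c =>
    obtain rfl : a = [] := by simpa using hhead
    have := sum_add_length_of_isChain hc hlast
    simp only [List.sum_nil] at this
    rw [List.length_cons]
    omega
end

section
/- Let 1 ≤ m ≤ k and n ≥ k−m+1. Then the following identity holds in ℤ[q]: the sum of q^{|λ|} over all partitions λ contained in the rectangle (m^n) having at most k−m+1 parts strictly smaller than m equals G(k−m+1, m) + q^{k+1} · (∑_{i=0}^{n−k+m−2} q^{mi}) · G(k−m+1, m−1), where G(a,b) = ∑_{μ ⊆ (b^a)} q^{|μ|} is the generating function of partitions with at most a parts, each part at most b (the Gaussian binomial coefficient [a+b choose b]_q). Equivalently, the rank-generating function of L^k(m,n) is [k+1 choose m]_q + q^{k+1}·(1−q^{m(n−k+m−1)})/(1−q^m)·[k choose m−1]_q. -/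
open Polynomial in
/-- The Gaussian binomial coefficient `[a+b choose b]_q`: the generating function by
size of partitions with at most `a` parts, each part at most `b`. -/
noncomputable def Gq (a b : ℕ) : Polynomial ℤ :=
  ∑ i ∈ Finset.range (a * b + 1),
    (({l : List ℕ | IsPartition l ∧ l.length ≤ a ∧ (∀ x ∈ l, x ≤ b) ∧
        l.sum = i}.ncard : Polynomial ℤ)) * X ^ i

open Polynomial in
/-- The generating function by size of a (finite) set of lists. -/
noncomputable def sizeGenFun (S : Set (List ℕ)) : Polynomial ℤ :=
  ∑ᶠ l ∈ S, X ^ l.sum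

/-- Partitions with at most `a` parts, each part at most `b`. -/
def boxPartitions (a b : ℕ) : Set (List ℕ) :=
  {l | IsPartition l ∧ l.length ≤ a ∧ ∀ x ∈ l, x ≤ b}

/-- Partitions in the box `(m^n)` with at most `a` parts strictly smaller than `m`. -/
def fewSmallParts (a m n : ℕ) : Set (List ℕ) :=
  {l | l ∈ boxPartitions n m ∧ (l.filter (fun x => decide (x < m))).length ≤ a}

theorem finite_boxPartitions (a b : ℕ) : (boxPartitions a b).Finite := by
  refine ((List.finite_length_le (Fin (b + 1)) a).image (List.map Fin.val)).subset ?_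
  rintro l ⟨-, hl, hb⟩
  refine ⟨l.map (Fin.ofNat (b + 1)), by simpa using hl, ?_⟩
  rw [List.map_map]
  conv_rhs => rw [← List.map_id l]
  refine List.map_congr_left fun x hx => ?_
  simpa using Nat.mod_eq_of_lt (Nat.lt_succ_of_le (hb x hx))

theorem sum_le_of_mem_boxPartitions {a b : ℕ} {l : List ℕ} (h : l ∈ boxPartitions a b) :
    l.sum ≤ a * b := by
  have h1 := List.sum_le_card_nsmul l b h.2.2
  exact h1.trans (by simpa using Nat.mul_le_mul_right b h.2.1)

theorem finite_fewSmallParts (a m n : ℕ) : (fewSmallParts a m n).Finite :=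
  (finite_boxPartitions n m).subset fun _ h => h.1

open Polynomial in
theorem sum_ncard_mul_X_pow {S : Set (List ℕ)} (hS : S.Finite) {N : ℕ}
    (hN : ∀ l ∈ S, l.sum ≤ N) :
    ∑ i ∈ Finset.range (N + 1), (({l | l ∈ S ∧ l.sum = i}.ncard : Polynomial ℤ)) * X ^ i =
      sizeGenFun S := by
  classical
  obtain ⟨F, rfl⟩ := hS.exists_finset_coe
  rw [sizeGenFun, finsum_mem_coe_finset, ← Finset.sum_fiberwise_of_maps_to
    (g := List.sum) (t := Finset.range (N + 1))
    (fun l hl => Finset.mem_range.2 (Nat.lt_succ_of_le (hN l hl)))]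
  refine Finset.sum_congr rfl fun i _ => ?_
  have h : {l | l ∈ (F : Set (List ℕ)) ∧ l.sum = i} = ↑(F.filter fun l => l.sum = i) := by
    ext l; simp
  rw [h, Set.ncard_coe_finset, Finset.sum_congr rfl
    (fun l hl => by rw [(Finset.mem_filter.1 hl).2]), Finset.sum_const, nsmul_eq_mul]

theorem Gq_eq_sizeGenFun (a b : ℕ) : Gq a b = sizeGenFun (boxPartitions a b) := by
  rw [← sum_ncard_mul_X_pow (finite_boxPartitions a b)
    (fun _ => sum_le_of_mem_boxPartitions), Gq]
  simp only [boxPartitions, Set.mem_ofPred_eq, and_assoc]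

theorem IsPartition.subDiag_replicate_iff {l : List ℕ} (hl : IsPartition l) (n m : ℕ) :
    SubDiag l (List.replicate n m) ↔ l.length ≤ n ∧ ∀ x ∈ l, x ≤ m := by
  constructor
  · intro h
    have hlen : l.length ≤ n := by
      by_contra! hlt
      have h1 := h n
      have h2 := hl.2 _ (List.getElem_mem hlt)
      simp [part, List.getD_eq_getElem?_getD, hlt] at h1
      omega
    refine ⟨hlen, fun x hx => ?_⟩
    obtain ⟨i, hi, rfl⟩ := List.getElem_of_mem hx
    have h1 := h i
    simpa [part, List.getD_eq_getElem?_getD, hi, hi.trans_le hlen] using h1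
  · rintro ⟨h1, h2⟩ i
    by_cases hi : i < l.length
    · simpa [part, List.getD_eq_getElem?_getD, hi, hi.trans_le h1] using
        h2 _ (List.getElem_mem hi)
    · simp [part, List.getD_eq_getElem?_getD, hi]

/-- Prepend `r` parts equal to `m` to the partition obtained from `l` by adding `1` to each of
its first `a` parts, absent parts counting as `0`. -/
def extendPartition (a m r : ℕ) (l : List ℕ) : List ℕ :=
  List.replicate r m ++ (l.map (· + 1) ++ List.replicate (a - l.length) 1)

theorem length_extendPartition {a m r : ℕ} {l : List ℕ} (h : l.length ≤ a) :
    (extendPartition a m r l).length = r + a := by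
  simp [extendPartition]; omega

theorem sum_extendPartition {a m r : ℕ} {l : List ℕ} (h : l.length ≤ a) :
    (extendPartition a m r l).sum = m * r + a + l.sum := by
  have : (l.map (· + 1)).sum = l.sum + l.length := by
    simp [List.sum_map_add]
  simp [extendPartition, this, mul_comm]; omega

theorem injOn_extendPartition (a m b r : ℕ) :
    Set.InjOn (extendPartition a m r) (boxPartitions a b) := by
  have key : ∀ l ∈ boxPartitions a b,
      (((extendPartition a m r l).drop r).map (· - 1)).filter (0 < ·) = l := by
    rintro l ⟨⟨-, hl⟩, -, -⟩
    simp only [extendPartition, List.drop_left' List.length_replicate, List.map_append,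
      List.map_map, List.filter_append, List.map_replicate]
    simpa [Function.comp_def] using hl
  intro l hl l' hl' h
  rw [← key l hl, ← key l' hl', h]

theorem IsPartition.exists_map_succ_append {d : List ℕ} (hd : IsPartition d) :
    ∃ l, IsPartition l ∧ l.length ≤ d.length ∧
      d = l.map (· + 1) ++ List.replicate (d.length - l.length) 1 := by
  induction d with
  | nil => exact ⟨[], hd, by simp⟩
  | cons x d ih =>
    obtain ⟨hs, hp⟩ := hd
    rw [List.pairwise_cons] at hs
    have hx := hp x (by simp)
    by_cases h1 : x = 1
    · refine ⟨[], ⟨by simp, by simp⟩, by simp, ?_⟩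
      have : ∀ y ∈ x :: d, y = 1 := by
        intro y hy
        have := hp y hy
        rcases List.mem_cons.1 hy with h | h
        · omega
        · have := hs.1 y h
          omega
      simpa using List.eq_replicate_of_mem this
    · obtain ⟨l, ⟨hl1, hl2⟩, hl3, hl4⟩ := ih ⟨hs.2, fun y hy => hp y (by simp [hy])⟩
      refine ⟨(x - 1) :: l, ⟨List.pairwise_cons.2 ⟨fun y hy => ?_, hl1⟩, ?_⟩, by simpa using hl3, ?_⟩
      · have := hs.1 (y + 1) (by rw [hl4]; simp [hy])
        show y ≤ x - 1
        omega
      · intro y hy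
        rcases List.mem_cons.1 hy with h | h
        · omega
        · exact hl2 y h
      · simp only [List.map_cons, List.cons_append, List.length_cons, Nat.add_sub_add_right]
        rw [← hl4, Nat.sub_add_cancel hx]

theorem extendPartition_mem_fewSmallParts {a m r : ℕ} (hm : 1 ≤ m) {l : List ℕ}
    (hl : l ∈ boxPartitions a (m - 1)) :
    extendPartition a m r l ∈ fewSmallParts a m (r + a) := by
  obtain ⟨⟨h1, h2⟩, h3, h4⟩ := hl
  have h5 : ∀ x ∈ l, x + 1 ≤ m := fun x hx => by have := h4 x hx; omega
  refine ⟨⟨⟨?_, ?_⟩, (length_extendPartition h3).le, ?_⟩, ?_⟩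
  · simp only [extendPartition, List.pairwise_append, List.pairwise_replicate, List.pairwise_map]
    refine ⟨by simp, ⟨h1.imp fun h => Nat.succ_le_succ h, by simp, ?_⟩, ?_⟩
    · intro x hx y hy
      rw [List.eq_of_mem_replicate hy]
      obtain ⟨z, -, rfl⟩ := List.mem_map.1 hx
      show 1 ≤ z + 1
      omega
    · intro x hx y hy
      rw [List.eq_of_mem_replicate hx]
      rcases List.mem_append.1 hy with h | h
      · obtain ⟨z, hz, rfl⟩ := List.mem_map.1 h
        exact h5 z hz
      · rw [List.eq_of_mem_replicate h]
        exact hm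
  · simp only [extendPartition, List.mem_append, List.mem_replicate, List.mem_map]
    rintro x (h | ⟨z, -, rfl⟩ | h) <;> omega
  · simp only [extendPartition, List.mem_append, List.mem_replicate, List.mem_map]
    rintro x (h | ⟨z, hz, rfl⟩ | h)
    · omega
    · exact h5 z hz
    · omega
  · rw [extendPartition, List.filter_append, List.length_append]
    have : (List.replicate r m).filter (fun x => decide (x < m)) = [] := by simp
    rw [this, List.length_nil, Nat.zero_add]
    refine (List.length_filter_le _ _).trans ?_
    simp; omega

theorem take_eq_replicate_of_mem_fewSmallParts {a m r : ℕ} {l : List ℕ}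
    (hl : l ∈ fewSmallParts a m (r + a)) (hlen : l.length = r + a) :
    l.take r = List.replicate r m := by
  obtain ⟨⟨⟨h1, -⟩, -, h4⟩, h5⟩ := hl
  refine List.eq_replicate_iff.2 ⟨by simp [hlen], fun x hx => ?_⟩
  obtain ⟨i, hi, rfl⟩ := List.getElem_of_mem hx
  have hir : i < r := by simp at hi; omega
  have hil : i < l.length := by omega
  rw [List.getElem_take]
  refine le_antisymm (h4 _ (List.getElem_mem _)) ?_
  by_contra! hlt
  have hall : ∀ y ∈ l.drop i, y < m := by
    intro y hy
    obtain ⟨j, hj, rfl⟩ := List.getElem_of_mem hy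
    rw [List.getElem_drop]
    refine lt_of_le_of_lt ?_ hlt
    rcases Nat.eq_zero_or_pos j with rfl | hj0
    · simp
    · exact List.pairwise_iff_getElem.1 h1 _ _ _ _ (by omega)
  have h6 := ((List.drop_sublist i l).filter (fun x => decide (x < m))).length_le
  rw [List.filter_eq_self.2 (by simpa using hall), List.length_drop] at h6
  omega

theorem fewSmallParts_succ {a m r : ℕ} (hm : 1 ≤ m) :
    fewSmallParts a m (r + 1 + a) = fewSmallParts a m (r + a) ∪
      extendPartition a m (r + 1) '' boxPartitions a (m - 1) := by
  ext l
  constructor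
  · intro hl
    by_cases hlen : l.length = r + 1 + a
    · right
      have htake := take_eq_replicate_of_mem_fewSmallParts hl hlen
      obtain ⟨⟨⟨h1, h2⟩, h3, h4⟩, h5⟩ := hl
      have hd : IsPartition (l.drop (r + 1)) :=
        ⟨h1.sublist (List.drop_sublist _ _), fun x hx => h2 x (List.mem_of_mem_drop hx)⟩
      obtain ⟨u, hu1, hu2, hu3⟩ := hd.exists_map_succ_append
      have hda : (l.drop (r + 1)).length = a := by simp [hlen]
      rw [hda] at hu2 hu3
      refine ⟨u, ⟨hu1, hu2, fun x hx => ?_⟩, ?_⟩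
      · have := h4 (x + 1) (List.mem_of_mem_drop (i := r + 1) (by rw [hu3]; simp [hx]))
        omega
      · rw [extendPartition, ← hu3, ← htake, List.take_append_drop]
    · left
      obtain ⟨⟨h1, h3, h4⟩, h5⟩ := hl
      exact ⟨⟨h1, by omega, h4⟩, h5⟩
  · rintro (⟨⟨h1, h3, h4⟩, h5⟩ | ⟨u, hu, rfl⟩)
    · exact ⟨⟨h1, by omega, h4⟩, h5⟩
    · exact extendPartition_mem_fewSmallParts hm hu

open Polynomial in
theorem sizeGenFun_fewSmallParts_succ {a m r : ℕ} (hm : 1 ≤ m) :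
    sizeGenFun (fewSmallParts a m (r + 1 + a)) = sizeGenFun (fewSmallParts a m (r + a)) +
      X ^ (m * (r + 1) + a) * Gq a (m - 1) := by
  have hfin := finite_boxPartitions a (m - 1)
  have hdisj : Disjoint (fewSmallParts a m (r + a))
      (extendPartition a m (r + 1) '' boxPartitions a (m - 1)) := by
    rw [Set.disjoint_right]
    rintro _ ⟨u, hu, rfl⟩ h
    have h1 := h.1.2.1
    rw [length_extendPartition hu.2.1] at h1
    omega
  rw [fewSmallParts_succ hm, sizeGenFun,
    finsum_mem_union hdisj (finite_fewSmallParts _ _ _) (hfin.image _),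
    finsum_mem_image (injOn_extendPartition _ _ _ _), Gq_eq_sizeGenFun, sizeGenFun, sizeGenFun,
    mul_finsum_mem]
  congr 1
  refine finsum_mem_congr rfl fun l hl => ?_
  rw [sum_extendPartition hl.2.1, pow_add]

open Polynomial in
theorem sizeGenFun_fewSmallParts {a m : ℕ} (hm : 1 ≤ m) (r : ℕ) :
    sizeGenFun (fewSmallParts a m (r + a)) =
      Gq a m + X ^ (a + m) * (∑ t ∈ Finset.range r, X ^ (m * t)) * Gq a (m - 1) := by
  induction r with
  | zero =>
    have : fewSmallParts a m (0 + a) = boxPartitions a m := by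
      ext l
      refine ⟨fun h => by simpa using h.1, fun h => ⟨by simpa using h, ?_⟩⟩
      exact (List.length_filter_le _ _).trans h.2.1
    rw [this, Gq_eq_sizeGenFun]
    simp
  | succ r ih =>
    rw [sizeGenFun_fewSmallParts_succ hm, ih, Finset.sum_range_succ]
    ring

open Polynomial in
/-- the rank-generating function of `L^k(m,n)` equals
`[k+1 choose m]_q + q^{k+1}·(1-q^{m(n-k+m-1)})/(1-q^m)·[k choose m-1]_q`. -/
theorem kIdeal_rank_gen_fun (k m n : ℕ) (hm : 1 ≤ m) (hmk : m ≤ k)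
    (hn : k - m + 1 ≤ n) :
    (∑ i ∈ Finset.range (m * n + 1),
      (({l : List ℕ | IsPartition l ∧ SubDiag l (List.replicate n m) ∧
          (l.filter (fun x => decide (x < m))).length ≤ k - m + 1 ∧
          l.sum = i}.ncard : Polynomial ℤ)) * X ^ i)
    = Gq (k - m + 1) m +
        X ^ (k + 1) * (∑ t ∈ Finset.range (n - (k - m + 1)), X ^ (m * t)) *
          Gq (k - m + 1) (m - 1) := by
  have hset : ∀ i, {l : List ℕ | IsPartition l ∧ SubDiag l (List.replicate n m) ∧
      (l.filter (fun x => decide (x < m))).length ≤ k - m + 1 ∧ l.sum = i} =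
      {l | l ∈ fewSmallParts (k - m + 1) m n ∧ l.sum = i} := by
    intro i
    ext l
    simp only [fewSmallParts, boxPartitions, Set.mem_ofPred_eq, and_assoc]
    refine and_congr_right fun hl => ?_
    rw [hl.subDiag_replicate_iff, and_assoc]
  simp only [hset]
  rw [sum_ncard_mul_X_pow (finite_fewSmallParts _ _ _) (fun l hl => by
    simpa [mul_comm] using sum_le_of_mem_boxPartitions hl.1)]
  have h := sizeGenFun_fewSmallParts (a := k - m + 1) hm (n - (k - m + 1))
  rwa [Nat.sub_add_cancel hn, show k - m + 1 + m = k + 1 by omega] at h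
end

section
/- Let m ≥ 1 and D ≥ 0 be integers and let a_0, a_1, …, a_D be real numbers, extended by a_j = 0 for j < 0 and j > D. Define v_i = ∑_{t ≥ 0} a_{i−tm} for each integer i ≥ 0. If the sequence (v_0, v_1, v_2, …) is weakly increasing, then: (i) v_i = v_j for all integers i, j ≥ max(0, D−m+1); and (ii) for every ℓ ∈ {0, 1, …, m−1}, ∑_{j ≥ 0} a_{ℓ+jm} = (1/m) · ∑_{j=0}^{D} a_j. -/
/-- A sum over `range (k * m)` splits according to quotient and remainder modulo `m`. -/
theorem sum_range_mul_eq_sum_sum {M : Type*} [AddCommMonoid M] (f : ℕ → M) (k m : ℕ) :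
    ∑ n ∈ Finset.range (k * m), f n
      = ∑ j ∈ Finset.range k, ∑ l ∈ Finset.range m, f (l + j * m) := by
  induction k with
  | zero => simp
  | succ k ih =>
    rw [Nat.succ_mul, Finset.sum_range_add, ih, Finset.sum_range_succ]
    simp only [add_comm]

/-- A monotone function on `ℕ` that is `m`-periodic from `N` on, with `m ≥ 1`, is constant
from `N` on. -/
theorem Monotone.eq_of_eventually_periodic {β : Type*} [PartialOrder β] {v : ℕ → β}
    (hmono : Monotone v) {m N : ℕ} (hm : 1 ≤ m) (hper : ∀ i, N ≤ i → v (i + m) = v i)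
    {i : ℕ} (hi : N ≤ i) : v i = v N := by
  have hmul : ∀ k : ℕ, v (N + k * m) = v N := by
    intro k
    induction k with
    | zero => simp
    | succ k ih => rw [Nat.succ_mul, ← add_assoc, hper _ (Nat.le_add_right _ _), ih]
  refine le_antisymm ?_ (hmono hi)
  rw [← hmul i]
  exact hmono (by nlinarith)

/-- if `v_i = ∑_{t ≥ 0} a_{i - tm}` is weakly increasing, where `a`
vanishes outside `{0, …, D}`, then `v` is eventually constant from index `D - m + 1`
on, and each sieved sum `∑_j a_{ℓ + jm}` equals `(1/m)·∑_j a_j`. -/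
theorem sieved_sum_of_monotone (m D : ℕ) (hm : 1 ≤ m) (a : ℤ → ℝ)
    (ha0 : ∀ j : ℤ, j < 0 → a j = 0) (haD : ∀ j : ℤ, (D : ℤ) < j → a j = 0)
    (v : ℕ → ℝ)
    (hv : ∀ i : ℕ, v i = ∑ t ∈ Finset.range (i + 1), a ((i : ℤ) - t * m))
    (hmono : Monotone v) :
    (∀ i j : ℕ, D + 1 - m ≤ i → D + 1 - m ≤ j → v i = v j) ∧
    (∀ ℓ : ℕ, ℓ < m →
      ∑ j ∈ Finset.range (D + 1), a ((ℓ : ℤ) + j * m)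
        = (∑ j ∈ Finset.range (D + 1), a (j : ℤ)) / m) := by
  have hstep : ∀ i : ℕ, v (i + m) = v i + a ((i : ℤ) + m) := by
    intro i
    have hsub : Finset.range (i + 1) ⊆ Finset.range (i + m) :=
      Finset.range_mono (by omega)
    rw [hv, hv, Finset.sum_range_succ']
    congr 1
    · rw [Finset.sum_subset hsub]
      · refine Finset.sum_congr rfl fun t _ => congrArg a ?_
        push_cast
        ring
      · intro t _ ht
        have ht' : i + 1 ≤ t := by simpa using ht
        apply ha0
        have htz : (i : ℤ) + 1 ≤ t := by exact_mod_cast ht'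
        have hmz : (1 : ℤ) ≤ m := by exact_mod_cast hm
        nlinarith
    · simp
  have hconst : ∀ i : ℕ, D + 1 - m ≤ i → v i = v (D + 1 - m) := by
    intro i hi
    refine hmono.eq_of_eventually_periodic hm (fun n hn => ?_) hi
    rw [hstep, haD _ (by omega), add_zero]
  have hsieve : ∀ l : ℕ, l < m →
      ∑ j ∈ Finset.range (D + 1), a ((l : ℤ) + j * m) = v (D + 1 - m) := by
    intro l hl
    have hD : D ≤ D * m := Nat.le_mul_of_pos_right D hm
    have hsub : Finset.range (D + 1) ⊆ Finset.range (l + D * m + 1) :=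
      Finset.range_mono (by omega)
    rw [← hconst (l + D * m) (by omega), hv, ← Finset.sum_range_reflect,
      ← Finset.sum_subset hsub]
    · refine Finset.sum_congr rfl fun t ht => congrArg a ?_
      have ht' : t ≤ D := by simpa [Nat.lt_succ_iff] using ht
      rw [Nat.add_sub_cancel, Nat.cast_sub ht']
      push_cast
      ring
    · intro t _ ht
      have ht' : D + 1 ≤ t := by simpa using ht
      apply ha0
      have htz : (D : ℤ) + 1 ≤ t := by exact_mod_cast ht'
      have hlz : (l : ℤ) < m := by exact_mod_cast hl
      push_cast
      nlinarith
  refine ⟨fun i j hi hj => (hconst i hi).trans (hconst j hj).symm, fun l hl => ?_⟩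
  have htotal : ∑ j ∈ Finset.range (D + 1), a (j : ℤ) = m * v (D + 1 - m) := by
    have hsub : Finset.range (D + 1) ⊆ Finset.range ((D + 1) * m) :=
      Finset.range_mono (Nat.le_mul_of_pos_right _ hm)
    rw [Finset.sum_subset hsub]
    · rw [sum_range_mul_eq_sum_sum (fun n : ℕ => a (n : ℤ)), Finset.sum_comm]
      push_cast
      rw [Finset.sum_congr rfl fun l hl => hsieve l (Finset.mem_range.mp hl)]
      simp
    · intro t _ ht
      have ht' : D + 1 ≤ t := by simpa using ht
      exact haD _ (by omega)
  have hm0 : (m : ℝ) ≠ 0 := by positivity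
  rw [hsieve l hl, htotal, mul_div_cancel_left₀ _ hm0]
end
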